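/- arXiv:2207.02761 — 3 statements merged into one kernel-verified Lean document; each statement's English description precedes it below -/
import Mathlib

section
/- Explicit kernel composition formula in a tangential direction: for all integers 0 ≤ m ≤ n, every index 1 ≤ i ≤ m, all a, b ∈ ℕ, and all Z, Z' ∈ ℂⁿ, the function W ↦ 𝒫^{⊥,0}_{n,m}(Z,W) · w_i^a · conj(w_i)^b · 𝒫^{⊥,0}_{n,m}(W,Z') is integrable on ℂⁿ and ∫_{ℂⁿ} 𝒫^{⊥,0}_{n,m}(Z,W) · w_i^a · conj(w_i)^b · 𝒫^{⊥,0}_{n,m}(W,Z') dV(W) = (Σ_{j=0}^{min(a,b)} π^{−j} · a!·b! / ((a−j)!·(b−j)!·j!) · z_i^{a−j} · conj(z'_i)^{b−j}) · 𝒫^{⊥,0}_{n,m}(Z,Z'). -/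
open MeasureTheory
open scoped Real

/-- The model orthogonal Bergman kernel of order `0`, `𝒫^{⊥,0}_{n,m}`, on `ℂⁿ` with
`n = m + q`; the first `m` coordinates are tangential, the last `q` normal. -/
noncomputable def modelOrthKernel0 (m q : ℕ) (Z Z' : Fin (m + q) → ℂ) : ℂ :=
  Complex.exp (-(π : ℂ) / 2 *
      ((∑ i : Fin m, ((‖Z (Fin.castAdd q i)‖ : ℂ) ^ 2 + (‖Z' (Fin.castAdd q i)‖ : ℂ) ^ 2
          - 2 * Z (Fin.castAdd q i) * (starRingEnd ℂ) (Z' (Fin.castAdd q i))))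
        + ∑ j : Fin q, ((‖Z (Fin.natAdd m j)‖ : ℂ) ^ 2 + (‖Z' (Fin.natAdd m j)‖ : ℂ) ^ 2)))


/-- The monomial `w ^ a * conj w ^ b` times the Gaussian `exp (-π ‖w‖²)` times the exponential of a
linear form in `w` and `conj w`. -/
noncomputable def gaussianMonomial (a b : ℕ) (c d w : ℂ) : ℂ :=
  w ^ a * (starRingEnd ℂ) w ^ b *
    Complex.exp (-(π : ℂ) * (‖w‖ : ℂ) ^ 2 + π * (c * (starRingEnd ℂ) w + d * w))

theorem continuous_gaussianMonomial (a b : ℕ) (c d : ℂ) : Continuous (gaussianMonomial a b c d) := by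
  unfold gaussianMonomial
  have := Complex.continuous_conj
  fun_prop

theorem norm_gaussianMonomial_le (a b : ℕ) (c d w : ℂ) :
    ‖gaussianMonomial a b c d w‖ ≤
      ‖w‖ ^ (a + b) * Real.exp (-π * ‖w‖ ^ 2 + π * ((‖c‖ + ‖d‖) * ‖w‖)) := by
  have h : (c * (starRingEnd ℂ) w + d * w).re ≤ (‖c‖ + ‖d‖) * ‖w‖ := by
    refine (Complex.re_le_norm _).trans ((norm_add_le _ _).trans_eq ?_)
    simp [add_mul]
  have hre : (-(π : ℂ) * (‖w‖ : ℂ) ^ 2 + π * (c * (starRingEnd ℂ) w + d * w)).re =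
      -π * ‖w‖ ^ 2 + π * (c * (starRingEnd ℂ) w + d * w).re := by
    rw [Complex.add_re, Complex.re_ofReal_mul, ← Complex.ofReal_neg, Complex.re_ofReal_mul,
      ← Complex.ofReal_pow, Complex.ofReal_re]
  rw [gaussianMonomial, norm_mul, norm_mul, norm_pow, norm_pow, RCLike.norm_conj, ← pow_add,
    Complex.norm_exp, hre]
  gcongr

theorem integrable_pow_norm_mul_gaussian (k : ℕ) (K : ℝ) :
    Integrable (fun w : ℂ => ‖w‖ ^ k * Real.exp (-π * ‖w‖ ^ 2 + π * (K * ‖w‖))) := by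
  have hg : Integrable (fun w : ℂ => Real.exp (-(π / 2) * ‖w‖ ^ 2)) := by
    have h := (GaussianFourier.integrable_cexp_neg_mul_sq_norm_add (V := ℂ) (b := (π / 2 : ℝ))
      (by simpa using by positivity) 0 0).norm
    refine h.congr (.of_forall fun w => ?_)
    simp only [Complex.norm_exp, zero_mul, add_zero]
    rw [← Complex.ofReal_neg, Complex.re_ofReal_mul, ← Complex.ofReal_pow, Complex.ofReal_re]
  refine (hg.const_mul (k.factorial * Real.exp ((1 + π * K) ^ 2 / (2 * π)))).mono'
    (by fun_prop) (.of_forall fun w => ?_)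
  rw [Real.norm_of_nonneg (by positivity)]
  have hk : ‖w‖ ^ k ≤ k.factorial * Real.exp ‖w‖ := by
    have := Real.pow_div_factorial_le_exp (x := ‖w‖) (norm_nonneg w) k
    rwa [div_le_iff₀' (by positivity)] at this
  calc _ ≤ (k.factorial * Real.exp ‖w‖) * Real.exp (-π * ‖w‖ ^ 2 + π * (K * ‖w‖)) := by gcongr
    _ = k.factorial * Real.exp (‖w‖ + (-π * ‖w‖ ^ 2 + π * (K * ‖w‖))) := by
      rw [Real.exp_add ‖w‖]; ring
    _ ≤ k.factorial * Real.exp ((1 + π * K) ^ 2 / (2 * π) + -(π / 2) * ‖w‖ ^ 2) := by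
      refine mul_le_mul_of_nonneg_left (Real.exp_le_exp.mpr ?_) (Nat.cast_nonneg _)
      have : (1 + π * K) ^ 2 / (2 * π) + -(π / 2) * ‖w‖ ^ 2
          - (‖w‖ + (-π * ‖w‖ ^ 2 + π * (K * ‖w‖))) = (π * ‖w‖ - (1 + π * K)) ^ 2 / (2 * π) := by
        field_simp; ring
      have : 0 ≤ (π * ‖w‖ - (1 + π * K)) ^ 2 / (2 * π) := by positivity
      linarith
    _ = _ := by rw [Real.exp_add]; ring

theorem integrable_gaussianMonomial (a b : ℕ) (c d : ℂ) :
    Integrable (gaussianMonomial a b c d) :=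
  (integrable_pow_norm_mul_gaussian (a + b) (‖c‖ + ‖d‖)).mono'
    (continuous_gaussianMonomial a b c d).aestronglyMeasurable
    (.of_forall fun w => norm_gaussianMonomial_le a b c d w)

theorem hasDerivAt_integral_gaussianMonomial (a b : ℕ) (c d : ℂ) :
    HasDerivAt (fun d => ∫ w, gaussianMonomial a b c d w)
      (π * ∫ w, gaussianMonomial (a + 1) b c d w) d := by
  rw [← integral_const_mul]
  refine (hasDerivAt_integral_of_dominated_loc_of_deriv_le (Metric.ball_mem_nhds d one_pos)
    (F' := fun d w => π * gaussianMonomial (a + 1) b c d w)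
    (bound := fun w => π * (‖w‖ ^ (a + 1 + b) *
      Real.exp (-π * ‖w‖ ^ 2 + π * ((‖c‖ + (‖d‖ + 1)) * ‖w‖))))
    (.of_forall fun x => (continuous_gaussianMonomial a b c x).aestronglyMeasurable)
    (integrable_gaussianMonomial a b c d)
    (continuous_const.mul (continuous_gaussianMonomial (a + 1) b c d)).aestronglyMeasurable
    (.of_forall fun w x hx => ?_)
    ((integrable_pow_norm_mul_gaussian _ _).const_mul _)
    (.of_forall fun w x _ => ?_)).2
  · have hxd : ‖x‖ ≤ ‖d‖ + 1 := by
      have := norm_le_norm_add_norm_sub d x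
      rw [Metric.mem_ball, dist_eq_norm] at hx
      rw [← norm_neg, neg_sub] at hx
      linarith
    rw [norm_mul, Complex.norm_real, Real.norm_of_nonneg Real.pi_pos.le]
    refine mul_le_mul_of_nonneg_left ((norm_gaussianMonomial_le _ _ _ _ _).trans ?_) Real.pi_pos.le
    gcongr
  · unfold gaussianMonomial
    have h : HasDerivAt (fun x : ℂ => -(π : ℂ) * (‖w‖ : ℂ) ^ 2
        + π * (c * (starRingEnd ℂ) w + x * w)) (π * w) x := by
      simpa using ((((hasDerivAt_id x).mul_const w).const_add
        (c * (starRingEnd ℂ) w)).const_mul (π : ℂ)).const_add (-(π : ℂ) * (‖w‖ : ℂ) ^ 2)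
    refine (h.cexp.const_mul (w ^ a * (starRingEnd ℂ) w ^ b)).congr_deriv ?_
    ring

theorem iteratedDeriv_integral_gaussianMonomial (a b : ℕ) (c : ℂ) :
    iteratedDeriv a (fun d => ∫ w, gaussianMonomial 0 b c d w) =
      fun d => π ^ a * ∫ w, gaussianMonomial a b c d w := by
  induction a with
  | zero => simp
  | succ a ih =>
    rw [iteratedDeriv_succ, ih]
    ext d
    rw [((hasDerivAt_integral_gaussianMonomial a b c d).const_mul _).deriv]
    ring

theorem integral_gaussianMonomial_swap (a b : ℕ) (c d : ℂ) :
    ∫ w, gaussianMonomial a b c d w = ∫ w, gaussianMonomial b a d c w := by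
  rw [← Complex.conjLIE.measurePreserving.integral_comp
    Complex.conjLIE.toHomeomorph.measurableEmbedding]
  refine integral_congr_ae (.of_forall fun w => ?_)
  simp only [gaussianMonomial, Complex.conjLIE_apply, Complex.conj_conj, RCLike.norm_conj]
  ring_nf

theorem integral_gaussianMonomial_zero_zero (c d : ℂ) :
    ∫ w, gaussianMonomial 0 0 c d w = Complex.exp (π * (c * d)) := by
  have hπ : (π : ℂ) ≠ 0 := Complex.ofReal_ne_zero.mpr Real.pi_ne_zero
  have hre : (-(π : ℂ)).re < 0 := by simpa using Real.pi_pos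
  rw [← Complex.volume_preserving_equiv_real_prod.symm.integral_comp
    Complex.measurableEquivRealProd.symm.measurableEmbedding]
  have h : ∀ p : ℝ × ℝ, gaussianMonomial 0 0 c d (Complex.measurableEquivRealProd.symm p) =
      Complex.exp (-(π : ℂ) * p.1 ^ 2 + π * (c + d) * p.1 + 0) *
      Complex.exp (-(π : ℂ) * p.2 ^ 2 + π * (d - c) * Complex.I * p.2 + 0) := by
    intro p
    have hw : Complex.measurableEquivRealProd.symm p = p.1 + p.2 * Complex.I := by
      rw [Complex.measurableEquivRealProd_symm_apply, Complex.mk_eq_add_mul_I]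
    rw [hw, gaussianMonomial, ← Complex.exp_add, ← Complex.mul_conj']
    simp only [map_add, map_mul, Complex.conj_ofReal, Complex.conj_I, pow_zero, one_mul]
    congr 1
    linear_combination (π * (p.2 : ℂ) ^ 2) * Complex.I_sq
  simp_rw [h]
  rw [Measure.volume_eq_prod, integral_prod_mul (fun x : ℝ =>
      Complex.exp (-(π : ℂ) * x ^ 2 + π * (c + d) * x + 0))
    (fun y : ℝ => Complex.exp (-(π : ℂ) * y ^ 2 + π * (d - c) * Complex.I * y + 0)),
    integral_cexp_quadratic hre, integral_cexp_quadratic hre, neg_neg, div_self hπ,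
    Complex.one_cpow, one_mul, one_mul, ← Complex.exp_add]
  congr 1
  field_simp
  linear_combination (π * (d - c) ^ 2) * Complex.I_sq

theorem integral_gaussianMonomial_zero_left (b : ℕ) (c d : ℂ) :
    ∫ w, gaussianMonomial 0 b c d w = d ^ b * Complex.exp (π * c * d) := by
  have hπ : (π : ℂ) ≠ 0 := Complex.ofReal_ne_zero.mpr Real.pi_ne_zero
  have h := congrFun (iteratedDeriv_integral_gaussianMonomial b 0 d) c
  simp only [integral_gaussianMonomial_zero_zero, ← mul_assoc] at h
  rw [iteratedDeriv_cexp_const_mul] at h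
  rw [integral_gaussianMonomial_swap]
  apply mul_left_cancel₀ (pow_ne_zero b hπ)
  rw [← h]
  ring_nf

theorem integral_gaussianMonomial (a b : ℕ) (c d : ℂ) :
    ∫ w, gaussianMonomial a b c d w =
      (∑ j ∈ Finset.range (min a b + 1),
          ((π : ℂ) ^ j)⁻¹ * ((a.factorial * b.factorial : ℕ) : ℂ)
            / (((a - j).factorial * (b - j).factorial * j.factorial : ℕ) : ℂ)
            * c ^ (a - j) * d ^ (b - j)) * Complex.exp (π * c * d) := by
  have hπ : (π : ℂ) ≠ 0 := Complex.ofReal_ne_zero.mpr Real.pi_ne_zero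
  have h := congrFun (iteratedDeriv_integral_gaussianMonomial a b c) d
  simp only [integral_gaussianMonomial_zero_left] at h
  have hmul := iteratedDeriv_mul (n := a) (x := d) (f := fun d : ℂ => d ^ b)
    (g := fun d => Complex.exp (π * c * d)) (by fun_prop) (by fun_prop)
  rw [show (fun d : ℂ => d ^ b * Complex.exp (π * c * d)) =
    (fun d : ℂ => d ^ b) * fun d => Complex.exp (π * c * d) from rfl, hmul] at h
  apply mul_left_cancel₀ (pow_ne_zero a hπ)
  rw [← h, Finset.sum_mul, Finset.mul_sum]
  symm
  refine Finset.sum_subset_zero_on_sdiff (Finset.range_mono (by omega)) (fun j hj => ?_)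
    (fun j hj => ?_)
  · simp only [Finset.mem_sdiff, Finset.mem_range] at hj
    rw [iteratedDeriv_pow, Nat.descFactorial_eq_zero_iff_lt.mpr (by omega)]
    simp
  · have hj' := Finset.mem_range.mp hj
    have ha : j ≤ a := by omega
    have hb : j ≤ b := by omega
    rw [iteratedDeriv_pow, iteratedDeriv_cexp_const_mul, Nat.cast_choose ℂ ha,
      Nat.descFactorial_eq_div hb, Nat.cast_div (Nat.factorial_dvd_factorial (Nat.sub_le b j))
        (Nat.cast_ne_zero.mpr (Nat.factorial_ne_zero _))]
    have hp : (π : ℂ) ^ a = π ^ (a - j) * π ^ j := by rw [← pow_add, Nat.sub_add_cancel ha]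
    have h1 : ((a - j).factorial : ℂ) ≠ 0 := Nat.cast_ne_zero.mpr (Nat.factorial_ne_zero _)
    have h2 : ((b - j).factorial : ℂ) ≠ 0 := Nat.cast_ne_zero.mpr (Nat.factorial_ne_zero _)
    have h3 : (j.factorial : ℂ) ≠ 0 := Nat.cast_ne_zero.mpr (Nat.factorial_ne_zero _)
    rw [hp, mul_pow]
    push_cast
    field_simp

theorem modelOrthKernel0_eq (m q : ℕ) (Z Z' : Fin (m + q) → ℂ) :
    modelOrthKernel0 m q Z Z' =
      Complex.exp (-(π : ℂ) / 2 * (∑ l, (‖Z l‖ : ℂ) ^ 2 + ∑ l, (‖Z' l‖ : ℂ) ^ 2)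
        + π * ∑ l : Fin m, Z (Fin.castAdd q l) * (starRingEnd ℂ) (Z' (Fin.castAdd q l))) := by
  rw [modelOrthKernel0]
  congr 1
  simp only [Fin.sum_univ_add, Finset.sum_add_distrib, Finset.sum_sub_distrib, mul_assoc,
    ← Finset.mul_sum]
  ring

theorem statement11 (m q : ℕ) (i : Fin m) (a b : ℕ) (Z Z' : Fin (m + q) → ℂ) :
    (Integrable (fun W : Fin (m + q) → ℂ =>
        modelOrthKernel0 m q Z W * W (Fin.castAdd q i) ^ a
          * (starRingEnd ℂ) (W (Fin.castAdd q i)) ^ b * modelOrthKernel0 m q W Z') volume) ∧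
    (∫ W : Fin (m + q) → ℂ,
        modelOrthKernel0 m q Z W * W (Fin.castAdd q i) ^ a
          * (starRingEnd ℂ) (W (Fin.castAdd q i)) ^ b * modelOrthKernel0 m q W Z') =
      (∑ j ∈ Finset.range (min a b + 1),
          ((π : ℂ) ^ j)⁻¹ * ((a.factorial * b.factorial : ℕ) : ℂ)
            / (((a - j).factorial * (b - j).factorial * j.factorial : ℕ) : ℂ)
            * Z (Fin.castAdd q i) ^ (a - j)
            * (starRingEnd ℂ) (Z' (Fin.castAdd q i)) ^ (b - j))
        * modelOrthKernel0 m q Z Z' := by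
  set k := Fin.castAdd q i with hk
  set c : Fin (m + q) → ℂ := Fin.append (fun l => Z (Fin.castAdd q l)) 0 with hc
  set d : Fin (m + q) → ℂ :=
    Fin.append (fun l => (starRingEnd ℂ) (Z' (Fin.castAdd q l))) 0 with hd
  set A : Fin (m + q) → ℕ := Pi.single k a with hA
  set B : Fin (m + q) → ℕ := Pi.single k b with hB
  set C : ℂ := Complex.exp (-(π : ℂ) / 2 * (∑ l, (‖Z l‖ : ℂ) ^ 2 + ∑ l, (‖Z' l‖ : ℂ) ^ 2)) with hC
  have hpow : ∀ (e : ℕ) (f : Fin (m + q) → ℂ), ∏ l, f l ^ (Pi.single k e : _ → ℕ) l = f k ^ e := by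
    intro e f
    rw [Finset.prod_eq_single k (fun l _ hl => by simp [hl]) (by simp), Pi.single_eq_same]
  have hint : (fun W : Fin (m + q) → ℂ =>
      modelOrthKernel0 m q Z W * W k ^ a * (starRingEnd ℂ) (W k) ^ b * modelOrthKernel0 m q W Z') =
      fun W => C * ∏ l, gaussianMonomial (A l) (B l) (c l) (d l) (W l) := by
    ext W
    simp only [gaussianMonomial, Finset.prod_mul_distrib]
    rw [hA, hB, hpow a W, hpow b (fun l => (starRingEnd ℂ) (W l)), ← Complex.exp_sum]
    rw [show ∀ x y z w : ℂ, x * y * z * w = (y * z) * (x * w) from fun _ _ _ _ => by ring,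
      show ∀ x y z w : ℂ, x * (y * z * w) = (y * z) * (x * w) from fun _ _ _ _ => by ring,
      modelOrthKernel0_eq, modelOrthKernel0_eq, hC, ← Complex.exp_add, ← Complex.exp_add]
    congr 2
    simp only [Finset.sum_add_distrib, ← Finset.mul_sum]
    rw [Fin.sum_univ_add (fun l => c l * _), Fin.sum_univ_add (fun l => d l * _)]
    simp only [hc, hd, Fin.append_left, Fin.append_right, Pi.zero_apply, zero_mul,
      Finset.sum_const_zero, add_zero, mul_comm ((starRingEnd ℂ) (Z' _))]
    ring
  have hval : C * ∏ l, Complex.exp (π * c l * d l) = modelOrthKernel0 m q Z Z' := by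
    rw [← Complex.exp_sum, modelOrthKernel0_eq, hC, ← Complex.exp_add,
      Fin.sum_univ_add (fun l => π * c l * d l)]
    simp [hc, hd, Finset.mul_sum, mul_assoc]
  rw [hint]
  refine ⟨(Integrable.fintype_prod fun l =>
    integrable_gaussianMonomial (A l) (B l) (c l) (d l)).const_mul C, ?_⟩
  rw [integral_const_mul, integral_fintype_prod_volume_eq_prod
    (fun l w => gaussianMonomial (A l) (B l) (c l) (d l) w)]
  simp only [integral_gaussianMonomial, Finset.prod_mul_distrib]
  rw [mul_left_comm, hval, Finset.prod_eq_single k (fun l _ hl => by simp [hA, hB, hl]) (by simp)]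
  simp only [hA, hB, Pi.single_eq_same, hc, hd, hk, Fin.append_left]
end

section
/- Explicit kernel composition formula in a normal direction: for all integers 0 ≤ m ≤ n, every index m+1 ≤ i ≤ n, all a, b ∈ ℕ, and all Z, Z' ∈ ℂⁿ, the function W ↦ 𝒫^{⊥,0}_{n,m}(Z,W) · w_i^a · conj(w_i)^b · 𝒫^{⊥,0}_{n,m}(W,Z') is integrable on ℂⁿ, and its integral equals (a!/π^a) · 𝒫^{⊥,0}_{n,m}(Z,Z') if a = b, and equals 0 if a ≠ b. -/
open MeasureTheory
open scoped Real

open Complex ComplexConjugate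

lemma integrable_cexp_neg_pi_mul_normSq_add (z c : ℂ) :
    Integrable (fun w : ℂ => cexp (-π * (‖w‖ : ℂ) ^ 2 + π * (z * conj w + c * w))) ∧
      ∫ w : ℂ, cexp (-π * (‖w‖ : ℂ) ^ 2 + π * (z * conj w + c * w)) = cexp (π * (z * c)) := by
  have hπ : 0 < (π : ℂ).re := by simpa using Real.pi_pos
  let d : Fin 2 → ℂ := ![π * (z + c), π * ((c - z) * I)]
  have h : (fun w : ℂ => cexp (-π * (‖w‖ : ℂ) ^ 2 + π * (z * conj w + c * w))) =
      (fun v : Fin 2 → ℝ => cexp (-π * ∑ i, (v i : ℂ) ^ 2 + ∑ i, d i * v i)) ∘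
        measurableEquivPi := by
    funext w
    have hn : (‖w‖ : ℂ) ^ 2 = (w.re : ℂ) ^ 2 + (w.im : ℂ) ^ 2 := by
      rw [← ofReal_pow, Complex.sq_norm, normSq_apply]
      push_cast
      ring
    have hw : w = w.re + w.im * I := (re_add_im w).symm
    have hc : conj w = w.re - w.im * I := by
      apply Complex.ext <;> simp
    simp only [Function.comp_apply, measurableEquivPi_apply, Fin.sum_univ_two, d,
      Matrix.cons_val_zero, Matrix.cons_val_one, hn, hc]
    conv_lhs => rw [show c * w = c * (w.re + w.im * I) by rw [← hw]]
    congr 1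
    ring
  rw [h, volume_preserving_equiv_pi.integrable_comp_emb measurableEquivPi.measurableEmbedding]
  refine ⟨GaussianFourier.integrable_cexp_neg_mul_sum_add hπ d, ?_⟩
  have hcomp := volume_preserving_equiv_pi.integral_comp'
    (fun v : Fin 2 → ℝ => cexp (-π * ∑ i, (v i : ℂ) ^ 2 + ∑ i, d i * v i))
  refine hcomp.trans ?_
  rw [GaussianFourier.integral_cexp_neg_mul_sum_add hπ d]
  have hπ0 : (π : ℂ) ≠ 0 := by exact_mod_cast Real.pi_ne_zero
  rw [div_self hπ0, one_cpow, one_mul]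
  congr 1
  simp only [d, Fin.sum_univ_two, Matrix.cons_val_zero, Matrix.cons_val_one]
  field_simp
  linear_combination (c - z) ^ 2 * I_sq

lemma integral_norm_pow_mul_exp_neg_pi_mul_sq (k : ℕ) :
    ∫ w : ℂ, ‖w‖ ^ k * Real.exp (-π * ‖w‖ ^ 2) =
      π * π ^ (-((k : ℝ) + 2) / 2) * Real.Gamma (((k : ℝ) + 2) / 2) := by
  have := Complex.integral_rpow_mul_exp_neg_mul_rpow (p := 2) (q := k) one_le_two
    (by linarith [k.cast_nonneg (α := ℝ)]) Real.pi_pos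
  simp only [Real.rpow_natCast, Real.rpow_two] at this
  rw [this]
  ring

lemma integrable_pow_mul_conj_pow_mul_gaussian (a b : ℕ) :
    Integrable (fun w : ℂ => w ^ a * conj w ^ b * cexp (-π * (‖w‖ : ℂ) ^ 2)) := by
  have hint : Integrable (fun w : ℂ => ‖w‖ ^ (a + b) * Real.exp (-π * ‖w‖ ^ 2)) := by
    refine .of_integral_ne_zero ?_
    rw [integral_norm_pow_mul_exp_neg_pi_mul_sq]
    have : 0 < Real.Gamma ((((a + b : ℕ) : ℝ) + 2) / 2) := Real.Gamma_pos_of_pos (by positivity)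
    positivity
  refine hint.mono' (by fun_prop) (.of_forall fun w => le_of_eq ?_)
  rw [norm_mul, norm_mul, norm_pow, norm_pow, RCLike.norm_conj, ← pow_add, norm_exp]
  norm_cast

lemma integral_pow_mul_conj_pow_mul_gaussian (a b : ℕ) :
    ∫ w : ℂ, w ^ a * conj w ^ b * cexp (-π * (‖w‖ : ℂ) ^ 2) =
      if a = b then (a.factorial : ℂ) / (π : ℂ) ^ a else 0 := by
  split_ifs with hab
  · subst hab
    have h : ∀ w : ℂ, w ^ a * conj w ^ a * cexp (-π * (‖w‖ : ℂ) ^ 2) =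
        ((‖w‖ ^ (2 * a) * Real.exp (-π * ‖w‖ ^ 2) : ℝ) : ℂ) := by
      intro w
      rw [← mul_pow, mul_conj, normSq_eq_norm_sq]
      push_cast
      ring
    simp_rw [h]
    rw [integral_complex_ofReal, integral_norm_pow_mul_exp_neg_pi_mul_sq]
    have h1 : (((2 * a : ℕ) : ℝ) + 2) / 2 = a + 1 := by push_cast; ring
    have h2 : -(((2 * a : ℕ) : ℝ) + 2) / 2 = -((a + 1 : ℕ) : ℝ) := by push_cast; ring
    rw [h1, h2, Real.Gamma_nat_eq_factorial, Real.rpow_neg Real.pi_pos.le, Real.rpow_natCast]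
    have hπ0 : (π : ℂ) ≠ 0 := by exact_mod_cast Real.pi_ne_zero
    push_cast
    field_simp
    ring
  · have hd : (a : ℂ) - b ≠ 0 := sub_ne_zero.2 (by exact_mod_cast hab)
    let u : Circle := Circle.exp (π / ((a : ℝ) - b))
    have hu : (u : ℂ) ^ a * conj (u : ℂ) ^ b = -1 := by
      simp only [u, Circle.coe_exp, ← exp_conj, ← Complex.exp_nat_mul, ← Complex.exp_add]
      rw [← exp_pi_mul_I]
      congr 1
      simp only [map_mul, conj_ofReal, conj_I]
      push_cast
      field_simp
      ring
    have hrot := ((rotation u).measurePreserving).integral_comp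
      (rotation u).toHomeomorph.measurableEmbedding
      (fun w : ℂ => w ^ a * conj w ^ b * cexp (-π * (‖w‖ : ℂ) ^ 2))
    have hneg : ∀ w : ℂ, (rotation u w) ^ a * conj (rotation u w) ^ b *
        cexp (-π * (‖rotation u w‖ : ℂ) ^ 2) =
        -(w ^ a * conj w ^ b * cexp (-π * (‖w‖ : ℂ) ^ 2)) := by
      intro w
      rw [LinearIsometryEquiv.norm_map, rotation_apply, map_mul, mul_pow, mul_pow]
      linear_combination (w ^ a * conj w ^ b * cexp (-π * (‖w‖ : ℂ) ^ 2)) * hu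
    simp_rw [hneg] at hrot
    rw [integral_neg] at hrot
    exact self_eq_neg.mp hrot.symm

/-- The Gaussian factor by which `modelOrthKernel0` depends on a normal coordinate. -/
noncomputable def gaussianWeight (z z' : ℂ) : ℂ :=
  cexp (-(π : ℂ) / 2 * ((‖z‖ : ℂ) ^ 2 + (‖z'‖ : ℂ) ^ 2))

lemma modelOrthKernel0_eq_prod (m q : ℕ) (Z Z' : Fin (m + q) → ℂ) :
    modelOrthKernel0 m q Z Z' = (∏ k, gaussianWeight (Z k) (Z' k)) *
      ∏ k : Fin m, cexp (π * (Z (Fin.castAdd q k) * conj (Z' (Fin.castAdd q k)))) := by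
  simp only [modelOrthKernel0, gaussianWeight, ← Complex.exp_sum, ← Complex.exp_add]
  congr 1
  rw [Fin.sum_univ_add, mul_add, Finset.mul_sum, Finset.mul_sum, add_right_comm,
    ← Finset.sum_add_distrib]
  congr 1
  refine Finset.sum_congr rfl fun k _ => ?_
  ring

/-- The factor depending on `W k` of `W ↦ 𝒫(Z, W) w_i^a conj(w_i)^b 𝒫(W, Z')`. -/
noncomputable def compositionFactor (m q : ℕ) (i : Fin q) (a b : ℕ) (Z Z' : Fin (m + q) → ℂ)
    (k : Fin (m + q)) (w : ℂ) : ℂ :=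
  gaussianWeight (Z k) (Z' k) *
    Fin.addCases (motive := fun _ => ℂ)
      (fun _ => cexp (-π * (‖w‖ : ℂ) ^ 2 + π * (Z k * conj w + conj (Z' k) * w)))
      (fun j => w ^ (if j = i then a else 0) * conj w ^ (if j = i then b else 0) *
        cexp (-π * (‖w‖ : ℂ) ^ 2)) k

lemma modelOrthKernel0_mul_eq_prod_compositionFactor (m q : ℕ) (i : Fin q) (a b : ℕ)
    (Z Z' W : Fin (m + q) → ℂ) :
    modelOrthKernel0 m q Z W * W (Fin.natAdd m i) ^ a
      * conj (W (Fin.natAdd m i)) ^ b * modelOrthKernel0 m q W Z' =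
    ∏ k, compositionFactor m q i a b Z Z' k (W k) := by
  have hpow : ∀ (v : Fin q → ℂ) (c : ℕ), ∏ j, v j ^ (if j = i then c else 0) = v i ^ c := by
    intro v c
    rw [Finset.prod_eq_single i (fun j _ hj => by simp [hj]) (by simp)]
    simp
  have htangential : (∏ k : Fin m, gaussianWeight (Z (Fin.castAdd q k)) (W (Fin.castAdd q k))) *
      (∏ k : Fin m, cexp (π * (Z (Fin.castAdd q k) * conj (W (Fin.castAdd q k))))) *
      (∏ k : Fin m, gaussianWeight (W (Fin.castAdd q k)) (Z' (Fin.castAdd q k))) *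
      (∏ k : Fin m, cexp (π * (W (Fin.castAdd q k) * conj (Z' (Fin.castAdd q k))))) =
      (∏ k : Fin m, gaussianWeight (Z (Fin.castAdd q k)) (Z' (Fin.castAdd q k))) *
      ∏ k : Fin m, cexp (-π * (‖W (Fin.castAdd q k)‖ : ℂ) ^ 2 + π *
        (Z (Fin.castAdd q k) * conj (W (Fin.castAdd q k)) +
          conj (Z' (Fin.castAdd q k)) * W (Fin.castAdd q k))) := by
    simp only [← Finset.prod_mul_distrib, gaussianWeight, ← Complex.exp_add]
    refine Finset.prod_congr rfl fun k _ => ?_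
    congr 1
    ring
  have hnormal : (∏ j : Fin q, gaussianWeight (Z (Fin.natAdd m j)) (W (Fin.natAdd m j))) *
      (∏ j : Fin q, gaussianWeight (W (Fin.natAdd m j)) (Z' (Fin.natAdd m j))) =
      (∏ j : Fin q, gaussianWeight (Z (Fin.natAdd m j)) (Z' (Fin.natAdd m j))) *
      ∏ j : Fin q, cexp (-π * (‖W (Fin.natAdd m j)‖ : ℂ) ^ 2) := by
    simp only [← Finset.prod_mul_distrib, gaussianWeight, ← Complex.exp_add]
    refine Finset.prod_congr rfl fun k _ => ?_
    congr 1
    ring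
  simp only [modelOrthKernel0_eq_prod, compositionFactor, Fin.prod_univ_add, Fin.addCases_left,
    Fin.addCases_right, Finset.prod_mul_distrib, hpow (fun j => W (Fin.natAdd m j)),
    hpow (fun j => conj (W (Fin.natAdd m j)))]
  have hmul := congrArg₂ (· * ·) htangential hnormal
  beta_reduce at hmul
  linear_combination W (Fin.natAdd m i) ^ a * conj (W (Fin.natAdd m i)) ^ b * hmul

lemma integrable_compositionFactor (m q : ℕ) (i : Fin q) (a b : ℕ) (Z Z' : Fin (m + q) → ℂ)
    (k : Fin (m + q)) : Integrable (compositionFactor m q i a b Z Z' k) := by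
  refine Integrable.const_mul ?_ _
  induction k using Fin.addCases with
  | left k =>
    simp only [Fin.addCases_left]
    exact (integrable_cexp_neg_pi_mul_normSq_add _ _).1
  | right j =>
    simp only [Fin.addCases_right]
    exact integrable_pow_mul_conj_pow_mul_gaussian _ _

lemma prod_integral_compositionFactor (m q : ℕ) (i : Fin q) (a b : ℕ)
    (Z Z' : Fin (m + q) → ℂ) :
    ∏ k, ∫ w, compositionFactor m q i a b Z Z' k w =
      (if a = b then (a.factorial : ℂ) / (π : ℂ) ^ a else 0) * modelOrthKernel0 m q Z Z' := by
  have hprod : ∏ j : Fin q, (if (if j = i then a else 0) = (if j = i then b else 0) then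
      ((if j = i then a else 0).factorial : ℂ) / (π : ℂ) ^ (if j = i then a else 0) else 0) =
      if a = b then (a.factorial : ℂ) / (π : ℂ) ^ a else 0 := by
    rw [Finset.prod_eq_single i (fun j _ hj => by simp [hj]) (by simp)]
    simp
  simp only [compositionFactor, integral_const_mul, Finset.prod_mul_distrib,
    modelOrthKernel0_eq_prod]
  rw [Fin.prod_univ_add (fun k => ∫ _, _)]
  simp only [Fin.addCases_left, Fin.addCases_right,
    (integrable_cexp_neg_pi_mul_normSq_add _ _).2, integral_pow_mul_conj_pow_mul_gaussian, hprod]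
  ring

theorem statement12 (m q : ℕ) (i : Fin q) (a b : ℕ) (Z Z' : Fin (m + q) → ℂ) :
    (Integrable (fun W : Fin (m + q) → ℂ =>
        modelOrthKernel0 m q Z W * W (Fin.natAdd m i) ^ a
          * (starRingEnd ℂ) (W (Fin.natAdd m i)) ^ b * modelOrthKernel0 m q W Z') volume) ∧
    (∫ W : Fin (m + q) → ℂ,
        modelOrthKernel0 m q Z W * W (Fin.natAdd m i) ^ a
          * (starRingEnd ℂ) (W (Fin.natAdd m i)) ^ b * modelOrthKernel0 m q W Z') =
      if a = b then ((a.factorial : ℕ) : ℂ) / (π : ℂ) ^ a * modelOrthKernel0 m q Z Z'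
      else 0 := by
  simp_rw [modelOrthKernel0_mul_eq_prod_compositionFactor]
  refine ⟨Integrable.fintype_prod fun k => integrable_compositionFactor m q i a b Z Z' k, ?_⟩
  rw [integral_fintype_prod_volume_eq_prod, prod_integral_compositionFactor, ite_mul, zero_mul]
end

section
/- Multiplicativity of the kernel calculus in separated variables: fix integers 0 ≤ m ≤ n, an index 1 ≤ i ≤ n, exponents a, b ∈ ℕ, and a polynomial P(W) in the 2n real coordinates of W ∈ ℂⁿ that does not depend on the two real coordinates of the i-th complex coordinate w_i. Then for all Z, Z' ∈ ℂⁿ, (∫_{ℂⁿ} 𝒫^{⊥,0}_{n,m}(Z,W)·P(W)·w_i^a·conj(w_i)^b·𝒫^{⊥,0}_{n,m}(W,Z') dV(W)) · 𝒫^{⊥,0}_{n,m}(Z,Z') = (∫_{ℂⁿ} 𝒫^{⊥,0}_{n,m}(Z,W)·P(W)·𝒫^{⊥,0}_{n,m}(W,Z') dV(W)) · (∫_{ℂⁿ} 𝒫^{⊥,0}_{n,m}(Z,W)·w_i^a·conj(w_i)^b·𝒫^{⊥,0}_{n,m}(W,Z') dV(W)), all three integrands being integrable. -/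
open MeasureTheory
open scoped Real

/-- The real coordinates of a point of `ℂⁿ`, viewed as complex numbers; the `2n`
coordinates are indexed by `Fin n ⊕ Fin n` (real parts, then imaginary parts). -/
noncomputable def realCoords {n : ℕ} (Z : Fin n → ℂ) : Fin n ⊕ Fin n → ℂ :=
  Sum.elim (fun i => ((Z i).re : ℂ)) (fun i => ((Z i).im : ℂ))

/-- The one-variable factor of the model kernel; `ε = 1` is a tangential and `ε = 0` a normal
coordinate. -/
noncomputable def kernelFactor (ε z w : ℂ) : ℂ :=
  Complex.exp (-(π : ℂ) / 2 *
    ((‖z‖ : ℂ) ^ 2 + (‖w‖ : ℂ) ^ 2 - 2 * ε * z * (starRingEnd ℂ) w))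

/-- The indicator of the tangential coordinates. -/
noncomputable def tangentialIndicator (m q : ℕ) (k : Fin (m + q)) : ℂ :=
  if (k : ℕ) < m then 1 else 0

lemma tangentialIndicator_sq (m q : ℕ) (k : Fin (m + q)) :
    tangentialIndicator m q k ^ 2 = tangentialIndicator m q k := by
  unfold tangentialIndicator
  split_ifs <;> simp

lemma modelOrthKernel0_eq_prod_s13 (m q : ℕ) (Z W : Fin (m + q) → ℂ) :
    modelOrthKernel0 m q Z W =
      ∏ k, kernelFactor (tangentialIndicator m q k) (Z k) (W k) := by
  simp [modelOrthKernel0, kernelFactor, ← Complex.exp_sum, ← Finset.mul_sum, Fin.sum_univ_add,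
    tangentialIndicator]
  congr 2
  ring

lemma continuous_kernelFactor_mul (ε z z' : ℂ) :
    Continuous fun w => kernelFactor ε z w * kernelFactor ε w z' := by
  unfold kernelFactor
  fun_prop

lemma norm_kernelFactor_le (ε z w : ℂ) :
    ‖kernelFactor ε z w‖ ≤
      Real.exp (-(π / 2) * ‖z‖ ^ 2 - π / 2 * ‖w‖ ^ 2 + π * ‖ε‖ * ‖z‖ * ‖w‖) := by
  rw [kernelFactor, Complex.norm_exp, Real.exp_le_exp]
  have h : (ε * z * (starRingEnd ℂ) w).re ≤ ‖ε‖ * ‖z‖ * ‖w‖ := by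
    simpa using Complex.re_le_norm (ε * z * (starRingEnd ℂ) w)
  have e : -(π : ℂ) / 2 * ((‖z‖ : ℂ) ^ 2 + (‖w‖ : ℂ) ^ 2 - 2 * ε * z * (starRingEnd ℂ) w)
      = ((-(π / 2) * ‖z‖ ^ 2 - π / 2 * ‖w‖ ^ 2 : ℝ) : ℂ)
        + (π : ℝ) * (ε * z * (starRingEnd ℂ) w) := by
    push_cast; ring
  rw [e, Complex.add_re, Complex.re_ofReal_mul, Complex.ofReal_re]
  nlinarith [Real.pi_pos]

lemma integrable_kernelFactor_mul (ε z z' : ℂ) {p : ℂ → ℂ} (hp : Continuous p) {N : ℕ}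
    (hN : ∀ w, ‖p w‖ ≤ ‖w‖ ^ N) :
    Integrable fun w => kernelFactor ε z w * kernelFactor ε w z' * p w := by
  set C : ℝ := π * ‖ε‖ * ‖z‖ + π * ‖ε‖ * ‖z'‖ + 1 with hC
  have hg : Integrable fun w : ℂ =>
      (N.factorial * Real.exp (C ^ 2 / (2 * π))) *
        ‖Complex.exp (-(π / 2 : ℂ) * (‖w‖ : ℂ) ^ 2 + 0 * (inner ℝ (0 : ℂ) w : ℝ))‖ :=
    ((GaussianFourier.integrable_cexp_neg_mul_sq_norm_add
      (by simpa using Real.pi_pos) 0 0).norm).const_mul _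
  refine hg.mono' ((continuous_kernelFactor_mul ε z z').mul hp).aestronglyMeasurable
    (.of_forall fun w => ?_)
  have e : ‖Complex.exp (-(π / 2 : ℂ) * (‖w‖ : ℂ) ^ 2 + 0 * (inner ℝ (0 : ℂ) w : ℝ))‖
      = Real.exp (-(π / 2) * ‖w‖ ^ 2) := by
    rw [Complex.norm_exp, zero_mul, add_zero]
    norm_cast
  have hw : ‖w‖ ^ N ≤ N.factorial * Real.exp ‖w‖ := by
    have := Real.pow_div_factorial_le_exp ‖w‖ (norm_nonneg _) N
    rwa [div_le_iff₀' (by positivity)] at this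
  have hsq : C * ‖w‖ ≤ C ^ 2 / (2 * π) + π / 2 * ‖w‖ ^ 2 := by
    have h : C ^ 2 / (2 * π) + π / 2 * ‖w‖ ^ 2 - C * ‖w‖ = (C - π * ‖w‖) ^ 2 / (2 * π) := by
      field_simp; ring
    have : 0 ≤ (C - π * ‖w‖) ^ 2 / (2 * π) := by positivity
    linarith
  rw [e, norm_mul, norm_mul]
  calc _ ≤ Real.exp (-(π / 2) * ‖z‖ ^ 2 - π / 2 * ‖w‖ ^ 2 + π * ‖ε‖ * ‖z‖ * ‖w‖) *
        Real.exp (-(π / 2) * ‖w‖ ^ 2 - π / 2 * ‖z'‖ ^ 2 + π * ‖ε‖ * ‖w‖ * ‖z'‖) *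
        (N.factorial * Real.exp ‖w‖) := by
        gcongr
        exacts [norm_kernelFactor_le _ _ _, norm_kernelFactor_le _ _ _, (hN w).trans hw]
    _ = N.factorial * Real.exp ((-(π / 2) * ‖z‖ ^ 2 - π / 2 * ‖w‖ ^ 2 + π * ‖ε‖ * ‖z‖ * ‖w‖) +
        (-(π / 2) * ‖w‖ ^ 2 - π / 2 * ‖z'‖ ^ 2 + π * ‖ε‖ * ‖w‖ * ‖z'‖) + ‖w‖) := by
        rw [mul_left_comm, ← Real.exp_add, ← Real.exp_add]
    _ ≤ N.factorial * Real.exp (C ^ 2 / (2 * π) + -(π / 2) * ‖w‖ ^ 2) := by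
        refine mul_le_mul_of_nonneg_left (Real.exp_le_exp.2 ?_) (by positivity)
        have h₁ : 0 ≤ π / 2 * ‖z‖ ^ 2 := by positivity
        have h₂ : 0 ≤ π / 2 * ‖z'‖ ^ 2 := by positivity
        rw [hC] at hsq ⊢
        linarith
    _ = _ := by rw [Real.exp_add]; ring

/-- The reproducing property of the one-variable kernels. -/
lemma integral_kernelFactor_mul (ε z z' : ℂ) :
    ∫ w, kernelFactor ε z w * kernelFactor ε w z' = kernelFactor (ε ^ 2) z z' := by
  have hpi : (π : ℂ) ≠ 0 := by exact_mod_cast Real.pi_ne_zero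
  set d : ℂ := -(π : ℂ) / 2 * ((‖z‖ : ℂ) ^ 2 + (‖z'‖ : ℂ) ^ 2)
  set c₁ : ℂ := π * ε * (z + (starRingEnd ℂ) z')
  set c₂ : ℂ := π * ε * Complex.I * ((starRingEnd ℂ) z' - z)
  have key : ∀ x : ℝ × ℝ,
      kernelFactor ε z (Complex.measurableEquivRealProd.symm x) *
        kernelFactor ε (Complex.measurableEquivRealProd.symm x) z' =
      Complex.exp (-(π : ℂ) * (x.1 : ℂ) ^ 2 + c₁ * x.1 + d) *
        Complex.exp (-(π : ℂ) * (x.2 : ℂ) ^ 2 + c₂ * x.2 + 0) := by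
    rintro ⟨x, y⟩
    have hn : (‖(⟨x, y⟩ : ℂ)‖ : ℂ) ^ 2 = (x : ℂ) ^ 2 + (y : ℂ) ^ 2 := by
      rw [← Complex.ofReal_pow, Complex.sq_norm, Complex.normSq_mk]; push_cast; ring
    have hx : (⟨x, y⟩ : ℂ) = x + y * Complex.I := Complex.mk_eq_add_mul_I x y
    rw [Complex.measurableEquivRealProd_symm_apply, kernelFactor, kernelFactor, ← Complex.exp_add,
      ← Complex.exp_add]
    simp only [hn]
    rw [hx]
    simp only [map_add, map_mul, Complex.conj_ofReal, Complex.conj_I, c₁, c₂, d]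
    congr 1
    ring
  have hre : (-(π : ℂ)).re < 0 := by simpa using Real.pi_pos
  rw [← Complex.volume_preserving_equiv_real_prod.symm.integral_comp'
    (g := fun w => kernelFactor ε z w * kernelFactor ε w z')]
  simp only [key]
  rw [Measure.volume_eq_prod, integral_prod_mul
    (fun x : ℝ => Complex.exp (-(π : ℂ) * (x : ℂ) ^ 2 + c₁ * x + d))
    (fun y : ℝ => Complex.exp (-(π : ℂ) * (y : ℂ) ^ 2 + c₂ * y + 0)),
    integral_cexp_quadratic hre, integral_cexp_quadratic hre, neg_neg, div_self hpi,
    Complex.one_cpow, one_mul, one_mul, ← Complex.exp_add, kernelFactor]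
  congr 1
  simp only [c₁, c₂, d]
  field_simp
  ring_nf
  simp only [Complex.I_sq]
  ring

lemma prod_apply_mul_eq_prod {ι : Type*} [Fintype ι] [DecidableEq ι]
    (f : ι → ℂ → ℂ) (i : ι) (u : ℂ → ℂ) (W : ι → ℂ) :
    (∏ k, f k (W k)) * u (W i) =
      ∏ k, (fun w => f k w * if k = i then u w else 1) (W k) := by
  rw [Finset.prod_mul_distrib, Finset.prod_ite_eq' _ i (fun k => u (W k))]
  simp

/-- Factorization of an integral of a product over separated variables, one factor of which
is modified by a weight. -/
lemma integral_prod_mul_mul_prod_integral {ι : Type*} [Fintype ι] [DecidableEq ι]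
    (f g : ι → ℂ → ℂ) (i : ι) (hfg : f i = g i) (u : ℂ → ℂ) :
    (∫ W : ι → ℂ, (∏ k, f k (W k)) * u (W i)) * ∏ k, ∫ w, g k w =
      (∫ W : ι → ℂ, ∏ k, f k (W k)) * ∫ W : ι → ℂ, (∏ k, g k (W k)) * u (W i) := by
  have h (f : ι → ℂ → ℂ) : ∫ W : ι → ℂ, (∏ k, f k (W k)) * u (W i) =
      (∫ w, f i w * u w) * ∏ k ∈ {i}ᶜ, ∫ w, f k w := by
    simp only [prod_apply_mul_eq_prod]
    rw [integral_fintype_prod_volume_eq_prod (fun k w => f k w * if k = i then u w else 1),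
      Fintype.prod_eq_mul_prod_compl i]
    congr 1
    · simp
    · refine Finset.prod_congr rfl fun k hk => ?_
      have : k ≠ i := by simpa using hk
      simp [this]
  rw [h f, h g, integral_fintype_prod_volume_eq_prod, Fintype.prod_eq_mul_prod_compl i,
    Fintype.prod_eq_mul_prod_compl i, hfg]
  ring

lemma integrable_prod_mul {ι : Type*} [Fintype ι] [DecidableEq ι]
    (f : ι → ℂ → ℂ) (hf : ∀ k, Integrable (f k)) (i : ι) (u : ℂ → ℂ)
    (hu : Integrable fun w => f i w * u w) :
    Integrable fun W : ι → ℂ => (∏ k, f k (W k)) * u (W i) := by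
  simp only [prod_apply_mul_eq_prod]
  refine Integrable.fintype_prod (f := fun k w => f k w * if k = i then u w else 1) fun k => ?_
  by_cases hk : k = i
  · subst hk; simpa using hu
  · simpa [hk] using hf k

/-- The monomial `(re w) ^ c * (im w) ^ d` in the real coordinates of `w`. -/
noncomputable def reImMonomial (c d : ℕ) (w : ℂ) : ℂ := (w.re : ℂ) ^ c * (w.im : ℂ) ^ d

lemma continuous_reImMonomial (c d : ℕ) : Continuous (reImMonomial c d) := by
  unfold reImMonomial
  fun_prop

lemma norm_reImMonomial_le (c d : ℕ) (w : ℂ) : ‖reImMonomial c d w‖ ≤ ‖w‖ ^ (c + d) := by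
  rw [reImMonomial, norm_mul, norm_pow, norm_pow, Complex.norm_real, Complex.norm_real, pow_add]
  gcongr
  exacts [Complex.abs_re_le_norm w, Complex.abs_im_le_norm w]

lemma eval_realCoords {n : ℕ} (P : MvPolynomial (Fin n ⊕ Fin n) ℂ) (W : Fin n → ℂ) :
    MvPolynomial.eval (realCoords W) P =
      ∑ s ∈ P.support, P.coeff s * ∏ k, reImMonomial (s (.inl k)) (s (.inr k)) (W k) := by
  simp [MvPolynomial.eval_eq', realCoords, reImMonomial, Finset.prod_mul_distrib]

theorem statement13 (m q : ℕ) (i : Fin (m + q)) (a b : ℕ)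
    (P : MvPolynomial (Fin (m + q) ⊕ Fin (m + q)) ℂ)
    (hP₁ : Sum.inl i ∉ P.vars) (hP₂ : Sum.inr i ∉ P.vars)
    (Z Z' : Fin (m + q) → ℂ) :
    (Integrable (fun W : Fin (m + q) → ℂ =>
        modelOrthKernel0 m q Z W * MvPolynomial.eval (realCoords W) P
          * W i ^ a * (starRingEnd ℂ) (W i) ^ b * modelOrthKernel0 m q W Z') volume) ∧
    (Integrable (fun W : Fin (m + q) → ℂ =>
        modelOrthKernel0 m q Z W * MvPolynomial.eval (realCoords W) P
          * modelOrthKernel0 m q W Z') volume) ∧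
    (Integrable (fun W : Fin (m + q) → ℂ =>
        modelOrthKernel0 m q Z W * W i ^ a * (starRingEnd ℂ) (W i) ^ b
          * modelOrthKernel0 m q W Z') volume) ∧
    (∫ W : Fin (m + q) → ℂ,
        modelOrthKernel0 m q Z W * MvPolynomial.eval (realCoords W) P
          * W i ^ a * (starRingEnd ℂ) (W i) ^ b * modelOrthKernel0 m q W Z')
        * modelOrthKernel0 m q Z Z' =
      (∫ W : Fin (m + q) → ℂ,
          modelOrthKernel0 m q Z W * MvPolynomial.eval (realCoords W) P
            * modelOrthKernel0 m q W Z')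
        * (∫ W : Fin (m + q) → ℂ,
            modelOrthKernel0 m q Z W * W i ^ a * (starRingEnd ℂ) (W i) ^ b
              * modelOrthKernel0 m q W Z') := by
  set g : Fin (m + q) → ℂ → ℂ := fun k w =>
    kernelFactor (tangentialIndicator m q k) (Z k) w *
      kernelFactor (tangentialIndicator m q k) w (Z' k) with hg
  set f : (Fin (m + q) ⊕ Fin (m + q) →₀ ℕ) → Fin (m + q) → ℂ → ℂ := fun s k w =>
    g k w * reImMonomial (s (.inl k)) (s (.inr k)) w with hf
  set u : ℂ → ℂ := fun w => w ^ a * (starRingEnd ℂ) w ^ b with hu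
  have hu_cont : Continuous u := by fun_prop
  have hu_norm (w : ℂ) : ‖u w‖ ≤ ‖w‖ ^ (a + b) := by simp [hu, pow_add]
  have hfi {s} (hs : s ∈ P.support) : f s i = g i := by
    have h₁ : s (.inl i) = 0 := by
      by_contra h
      exact hP₁ ((MvPolynomial.mem_vars_iff_mem_support _).2 ⟨s, hs, Finsupp.mem_support_iff.2 h⟩)
    have h₂ : s (.inr i) = 0 := by
      by_contra h
      exact hP₂ ((MvPolynomial.mem_vars_iff_mem_support _).2 ⟨s, hs, Finsupp.mem_support_iff.2 h⟩)
    ext w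
    simp [hf, h₁, h₂, reImMonomial]
  have hf_int (s k) : Integrable (f s k) :=
    integrable_kernelFactor_mul _ _ _ (continuous_reImMonomial _ _) (norm_reImMonomial_le _ _)
  have hgu_int (k) : Integrable fun w => g k w * u w :=
    integrable_kernelFactor_mul _ _ _ hu_cont hu_norm
  have hg_int (k) : Integrable (g k) := by
    simpa using integrable_kernelFactor_mul (tangentialIndicator m q k) (Z k) (Z' k)
      (p := fun _ => 1) continuous_const (N := 0) (by simp)
  have hkernel (W : Fin (m + q) → ℂ) :
      modelOrthKernel0 m q Z W * modelOrthKernel0 m q W Z' = ∏ k, g k (W k) := by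
    simp only [modelOrthKernel0_eq_prod_s13, hg, Finset.prod_mul_distrib]
  have hrepr : modelOrthKernel0 m q Z Z' = ∏ k, ∫ w, g k w := by
    simp only [hg, integral_kernelFactor_mul, tangentialIndicator_sq, modelOrthKernel0_eq_prod_s13]
  have hP (W : Fin (m + q) → ℂ) :
      modelOrthKernel0 m q Z W * MvPolynomial.eval (realCoords W) P * modelOrthKernel0 m q W Z' =
        ∑ s ∈ P.support, P.coeff s * ∏ k, f s k (W k) := by
    rw [mul_right_comm, hkernel, eval_realCoords, Finset.mul_sum]
    refine Finset.sum_congr rfl fun s _ => ?_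
    simp only [hf, Finset.prod_mul_distrib]
    ring
  have hPu (W : Fin (m + q) → ℂ) :
      modelOrthKernel0 m q Z W * MvPolynomial.eval (realCoords W) P
          * W i ^ a * (starRingEnd ℂ) (W i) ^ b * modelOrthKernel0 m q W Z' =
        ∑ s ∈ P.support, P.coeff s * ((∏ k, f s k (W k)) * u (W i)) := by
    simp only [← mul_assoc (P.coeff _)]
    rw [← Finset.sum_mul, ← hP]
    ring
  have hKu (W : Fin (m + q) → ℂ) :
      modelOrthKernel0 m q Z W * W i ^ a * (starRingEnd ℂ) (W i) ^ b
          * modelOrthKernel0 m q W Z' = (∏ k, g k (W k)) * u (W i) := by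
    rw [← hkernel]
    ring
  have hPu_int {s} (hs : s ∈ P.support) :
      Integrable fun W : Fin (m + q) → ℂ => P.coeff s * ((∏ k, f s k (W k)) * u (W i)) :=
    (integrable_prod_mul (f s) (hf_int s) i u (by rw [hfi hs]; exact hgu_int i)).const_mul _
  have hP_int (s) : Integrable fun W : Fin (m + q) → ℂ => P.coeff s * ∏ k, f s k (W k) :=
    (Integrable.fintype_prod (hf_int s)).const_mul _
  simp only [hP, hPu, hKu, hrepr]
  refine ⟨integrable_finsetSum _ fun s hs => hPu_int hs,
    integrable_finsetSum _ fun s _ => hP_int s,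
    integrable_prod_mul g hg_int i u (hgu_int i), ?_⟩
  rw [integral_finsetSum _ fun s hs => hPu_int hs, integral_finsetSum _ fun s _ => hP_int s,
    Finset.sum_mul, Finset.sum_mul]
  refine Finset.sum_congr rfl fun s hs => ?_
  rw [integral_const_mul, integral_const_mul, mul_assoc, mul_assoc,
    integral_prod_mul_mul_prod_integral (f s) g i (hfi hs) u]
end
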